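/- arXiv:2207.01935 — 10 statements merged into one kernel-verified Lean document; each statement's English description precedes it below -/
import Mathlib

section
/- For all natural numbers m ≥ 1, a ≥ 0 and n ≥ 1, the a-th order sequence has the closed form (as an identity of rational numbers) ψ_m^{(a)}(n) = B_{a+1,n−1} + (m·(m−1)/(m+a))·(n−1)·B_{m+a−1,n−1}. -/
/-- `binom a b = (a+b)!/(a!·b!) = C(a+b, a)`. -/
def binom (a b : ℕ) : ℕ := Nat.choose (a + b) a

/-- `psi m n = n + (m−1)·(n−1)·B_{m−1,n−1}`. -/
def psi (m n : ℕ) : ℕ := n + (m - 1) * (n - 1) * binom (m - 1) (n - 1)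

/-- `psiA m a n = ψ_m^{(a)}(n)`: `ψ_m^{(0)} = ψ_m`, `ψ_m^{(a)}(0) = 0` and
`ψ_m^{(a)}(n) = ψ_m^{(a)}(n−1) + ψ_m^{(a−1)}(n)` for `a, n ≥ 1`. -/
def psiA (m : ℕ) : ℕ → ℕ → ℕ
  | 0, n => psi m n
  | _ + 1, 0 => 0
  | a + 1, n + 1 => psiA m (a + 1) n + psiA m a (n + 1)

theorem choose_add_succ_mul (p j : ℕ) :
    (p + j).choose (p + 1) * (p + 1) = (p + j).choose p * j := by
  simpa using Nat.choose_succ_right_eq (p + j) p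

theorem psiA_succ_succ_closed_form (k a j : ℕ) :
    psiA (k + 1) a (j + 1) =
      (a + 1 + j).choose (a + 1) + (k + 1) * k * (k + a + j).choose (k + a + 1) := by
  induction a generalizing j with
  | zero =>
    have h := choose_add_succ_mul k j
    simp only [psiA, psi, binom, Nat.add_sub_cancel, Nat.add_zero, Nat.zero_add, Nat.choose_one_right]
    nlinarith [h]
  | succ a iha =>
    induction j with
    | zero => simp [psiA, iha, ← add_assoc]
    | succ j ihj =>
      rw [psiA, ihj, iha]
      have h₁ := Nat.choose_succ_succ (a + 1 + 1 + j) (a + 1)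
      have h₂ := Nat.choose_succ_succ (k + a + 1 + j) (k + a + 1)
      rw [show a + 1 + (j + 1) = a + 1 + 1 + j by ring,
        show k + a + (j + 1) = k + a + 1 + j by ring,
        show k + (a + 1) = k + a + 1 by ring,
        show a + 1 + 1 + (j + 1) = (a + 1 + 1 + j).succ by grind,
        show k + a + 1 + (j + 1) = (k + a + 1 + j).succ by grind, h₁, h₂]
      simp only [Nat.succ_eq_add_one]
      ring

theorem psiA_closed_form_rat (m a n : ℕ) (hm : 1 ≤ m) (hn : 1 ≤ n) :
    (psiA m a n : ℚ) =
      binom (a + 1) (n - 1) +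
        (m * (m - 1) / (m + a)) * (n - 1) * binom (m + a - 1) (n - 1) := by
  obtain ⟨k, rfl⟩ := Nat.exists_eq_add_of_le' hm
  obtain ⟨j, rfl⟩ := Nat.exists_eq_add_of_le' hn
  have h : ((k + a + j).choose (k + a + 1) : ℚ) * (k + a + 1) = (k + a + j).choose (k + a) * j :=
    mod_cast choose_add_succ_mul (k + a) j
  rw [psiA_succ_succ_closed_form, show k + 1 + a - 1 = k + a by omega]
  simp only [binom, Nat.add_sub_cancel]
  push_cast
  have hpos : (k : ℚ) + 1 + a ≠ 0 := by positivity
  field_simp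
  linear_combination (k : ℚ) * (k + 1) * h
end

section
/- For all natural numbers m ≥ 1, a ≥ 0 and n ≥ 2, one has the integer closed form ψ_m^{(a)}(n) = B_{a+1,n−1} + m·(m−1)·B_{m+a,n−2}; that is, ψ_m^{(a)}(n) = C(n+a, a+1) + m·(m−1)·C(m+a+n−2, m+a). -/
theorem psi_succ_succ (k j : ℕ) :
    psi (k + 1) (j + 1) = (j + 1) + (k + 1) * k * Nat.choose (k + j) (k + 1) := by
  have h := Nat.choose_succ_right_eq (k + j) k
  rw [Nat.add_sub_cancel_left] at h
  simp only [psi, binom, Nat.add_sub_cancel]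
  linear_combination k * h.symm

/-- The closed form, reindexed so that no truncated subtraction occurs; it also covers `n = 1`. -/
theorem psiA_succ_succ (k a j : ℕ) :
    psiA (k + 1) a (j + 1) = Nat.choose (j + a + 1) (a + 1) +
      (k + 1) * k * Nat.choose (k + a + j) (k + a + 1) := by
  induction a generalizing j with
  | zero => simp [psiA, psi_succ_succ]
  | succ a iha =>
    induction j with
    | zero => simp [psiA, iha]
    | succ j ihj =>
      rw [psiA, ihj, iha,
        show j + 1 + (a + 1) + 1 = (j + a + 2) + 1 by ring,
        show k + (a + 1) + (j + 1) = (k + a + j + 1) + 1 by ring,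
        Nat.choose_succ_succ' (j + a + 2), Nat.choose_succ_succ' (k + a + j + 1)]
      ring_nf

theorem psiA_closed_form_nat (m a n : ℕ) (hm : 1 ≤ m) (hn : 2 ≤ n) :
    psiA m a n = binom (a + 1) (n - 1) + m * (m - 1) * binom (m + a) (n - 2) ∧
      psiA m a n = Nat.choose (n + a) (a + 1) +
        m * (m - 1) * Nat.choose (m + a + n - 2) (m + a) := by
  obtain ⟨k, rfl⟩ := Nat.exists_eq_add_of_le' hm
  obtain ⟨j, rfl⟩ := Nat.exists_eq_add_of_le' hn
  have h := psiA_succ_succ k a (j + 1)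
  have hab : j + 1 + a + 1 = a + 1 + (j + 2 - 1) := by omega
  have hma : k + a + (j + 1) = k + 1 + a + (j + 2 - 2) := by omega
  rw [hab, hma, Nat.add_right_comm k a 1] at h
  refine ⟨h, ?_⟩
  rwa [show j + 2 + a = a + 1 + (j + 2 - 1) by omega,
    show k + 1 + a + (j + 2) - 2 = k + 1 + a + (j + 2 - 2) by omega]
end

section
/- For m ≥ 2 let P_m ∈ ℚ[X] be the polynomial P_m(X) = X + (1/(m−2)!)·∏_{k=0}^{m−1} (X − 1 + k). Then P_m(n) = ψ_m(n) for every natural number n ≥ 1, P_m has degree m, its leading coefficient (the coefficient of X^m) equals 1/(m−2)!, and its coefficients of X⁰ and X¹ both vanish. -/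
open Polynomial in
/-- The rising product `(X + 1)(X + 2)⋯(X + k)`. -/
noncomputable def risingProd (k : ℕ) : ℚ[X] :=
  ∏ j ∈ Finset.range k, (X + C ((j : ℚ) + 1))

open Polynomial in
theorem risingProd_succ (k : ℕ) :
    risingProd (k + 1) = risingProd k * (X + C ((k : ℚ) + 1)) :=
  Finset.prod_range_succ _ _

open Polynomial in
theorem risingProd_monic (k : ℕ) : (risingProd k).Monic :=
  monic_prod_of_monic _ _ fun _ _ => monic_X_add_C _

open Polynomial in
theorem natDegree_risingProd (k : ℕ) : (risingProd k).natDegree = k := by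
  rw [risingProd, natDegree_prod_of_monic _ _ fun _ _ => monic_X_add_C _]
  simp only [natDegree_X_add_C, Finset.sum_const, Finset.card_range, smul_eq_mul, mul_one]

theorem risingProd_eval_mul_factorial (k n : ℕ) :
    (risingProd k).eval (n : ℚ) * n.factorial = (n + k).factorial := by
  induction k with
  | zero => simp [risingProd]
  | succ k ih =>
    rw [risingProd_succ, Polynomial.eval_mul, mul_right_comm, ih, ← add_assoc,
      Nat.factorial_succ]
    simp only [Polynomial.eval_add, Polynomial.eval_X, Polynomial.eval_C]
    push_cast
    ring

theorem risingProd_coeff_zero (k : ℕ) : (risingProd k).coeff 0 = k.factorial := by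
  simpa [Polynomial.coeff_zero_eq_eval_zero] using risingProd_eval_mul_factorial k 0

open Polynomial in
theorem prod_shifted_eq (k : ℕ) :
    ∏ j ∈ Finset.range (k + 2), (X - C 1 + C (j : ℚ)) =
      X * ((X - C 1) * risingProd k) := by
  rw [Finset.prod_range_succ', Finset.prod_range_succ', risingProd,
    Finset.prod_congr rfl fun j _ => show
      (X - C 1 + C (((j + 1 + 1 : ℕ)) : ℚ) : ℚ[X]) = X + C ((j : ℚ) + 1) by
        push_cast
        simp only [C_add]
        ring]
  simp only [Nat.cast_zero, zero_add, Nat.cast_one, map_zero, map_one]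
  ring

open Polynomial in
theorem psi_polynomial (m : ℕ) (hm : 2 ≤ m) (P : Polynomial ℚ)
    (hP : P = X + C (1 / (Nat.factorial (m - 2) : ℚ)) *
        ∏ k ∈ Finset.range m, (X - C 1 + C (k : ℚ))) :
    (∀ n : ℕ, 1 ≤ n → P.eval (n : ℚ) = psi m n) ∧
      P.degree = m ∧
      P.coeff m = 1 / (Nat.factorial (m - 2) : ℚ) ∧
      P.coeff 0 = 0 ∧ P.coeff 1 = 0 := by
  obtain ⟨k, rfl⟩ := Nat.exists_eq_add_of_le' hm
  rw [prod_shifted_eq, Nat.add_sub_cancel] at hP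
  rw [Nat.add_sub_cancel]
  have hk : (k.factorial : ℚ) ≠ 0 := by positivity
  have hmonic : (X * ((X - C 1) * risingProd k) : ℚ[X]).Monic :=
    monic_X.mul ((monic_X_sub_C 1).mul (risingProd_monic k))
  have hnat : (X * ((X - C 1) * risingProd k) : ℚ[X]).natDegree = k + 2 := by
    rw [monic_X.natDegree_mul ((monic_X_sub_C 1).mul (risingProd_monic k)),
      (monic_X_sub_C 1).natDegree_mul (risingProd_monic k), natDegree_X, natDegree_X_sub_C,
      natDegree_risingProd]
    ring
  have hcoeff : P.coeff (k + 2) = 1 / (k.factorial : ℚ) := by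
    have htop : (X * ((X - C 1) * risingProd k) : ℚ[X]).coeff (k + 2) = 1 := by
      rw [← hnat]
      exact hmonic
    rw [hP, coeff_add, coeff_C_mul, htop, coeff_X_of_ne_one (by omega)]
    ring
  refine ⟨fun n hn => ?_, ?_, hcoeff, ?_, ?_⟩
  · obtain ⟨t, rfl⟩ := Nat.exists_eq_add_of_le' hn
    have hrising := risingProd_eval_mul_factorial k (t + 1)
    have hchoose : ((k + 1 + t).choose (k + 1) : ℚ) * (k + 1).factorial * t.factorial =
        (k + 1 + t).factorial := by
      rw [Nat.choose_symm_add]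
      exact_mod_cast Nat.add_choose_mul_factorial_mul_factorial (k + 1) t
    rw [show t + 1 + k = k + 1 + t by ring, ← hchoose, Nat.factorial_succ,
      Nat.factorial_succ] at hrising
    have ht : (t.factorial : ℚ) ≠ 0 := by positivity
    have heval : ((t : ℚ) + 1) * (risingProd k).eval ((t : ℚ) + 1) =
        (k + 1) * k.factorial * (k + 1 + t).choose (k + 1) := by
      apply mul_right_cancel₀ ht
      push_cast at hrising
      linear_combination hrising
    simp only [hP, psi, binom, eval_add, eval_mul, eval_sub, eval_X, eval_C,
      Nat.add_sub_cancel, show k + 2 - 1 = k + 1 from rfl]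
    push_cast
    field_simp
    linear_combination (t : ℚ) * heval
  · refine le_antisymm ?_ (le_degree_of_ne_zero (by rw [hcoeff]; positivity))
    rw [hP]
    refine (degree_add_le _ _).trans (max_le ?_ ?_)
    · rw [degree_X]
      exact_mod_cast (by omega : 1 ≤ k + 2)
    · rw [degree_C_mul (one_div_ne_zero hk)]
      exact degree_le_of_natDegree_le hnat.le
  · simp [hP]
  · rw [hP, coeff_add, coeff_C_mul, coeff_X_one, coeff_X_mul, mul_coeff_zero,
      risingProd_coeff_zero]
    simp [hk]
end

section
/- For every natural number m ≥ 2 there exist unique rational numbers c₂, c₃, …, c_m such that n^m = Σ_{k=2}^{m} c_k·ψ_k(n) holds for every natural number n ≥ 1; i.e., the monomial n^m admits a unique expansion in the basis {ψ_k}_{k=2}^{m}. -/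
open Polynomial in
/-- The polynomials interpolating `psi k` for `2 ≤ k`, completed by `1` and `X` in degrees
`0` and `1`. -/
noncomputable def psiPoly : ℕ → ℚ[X]
  | 0 => 1
  | 1 => X
  | 2 => X ^ 2
  | k + 3 => C ((k + 1 : ℚ)⁻¹) * ((X + C (k + 1 : ℚ)) * psiPoly (k + 2) - X ^ 2)

open Polynomial in
theorem psiPoly_degree : ∀ k, (psiPoly k).degree = k
  | 0 => by simp [psiPoly]
  | 1 => by simp [psiPoly]
  | 2 => by simp [psiPoly]
  | k + 3 => by
    have ih := psiPoly_degree (k + 2)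
    have hk : (k + 1 : ℚ) ≠ 0 := by positivity
    have hmul : ((X + C (k + 1 : ℚ)) * psiPoly (k + 2)).degree = ((k + 3 : ℕ) : WithBot ℕ) := by
      rw [degree_mul, degree_X_add_C, ih]
      norm_cast
      omega
    rw [psiPoly, degree_C_mul (inv_ne_zero hk), degree_sub_eq_left_of_degree_lt, hmul]
    rw [hmul, degree_X_pow]
    norm_cast
    omega

theorem psi_recurrence (k a : ℕ) :
    (k + 1) * psi (k + 3) (a + 1) + (a + 1) ^ 2 = (a + k + 2) * psi (k + 2) (a + 1) := by
  have h := Nat.add_one_mul_choose_eq (k + 1 + a) (k + 1)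
  have e : k + 2 + a = k + 1 + a + 1 := by omega
  simp only [psi, binom, Nat.add_sub_cancel, show k + 3 - 1 = k + 2 by omega,
    show k + 2 - 1 = k + 1 by omega, e]
  generalize (k + 1 + a).choose (k + 1) = u at *
  generalize (k + 1 + a + 1).choose (k + 2) = v at *
  zify at h ⊢
  linear_combination (-((k + 1) * a : ℤ)) * h

open Polynomial in
theorem psiPoly_eval : ∀ k a : ℕ,
    (psiPoly (k + 2)).eval ((a + 1 : ℕ) : ℚ) = psi (k + 2) (a + 1)
  | 0, a => by
    simp [psiPoly, psi, binom]
    ring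
  | k + 1, a => by
    have h := congrArg (Nat.cast : ℕ → ℚ) (psi_recurrence k a)
    have hk : (k + 1 : ℚ) ≠ 0 := by positivity
    push_cast at h
    simp only [psiPoly, eval_mul, eval_C, eval_sub, eval_add, eval_X, eval_pow, psiPoly_eval k a]
    push_cast
    field_simp
    linear_combination -h

open Polynomial in
theorem X_mul_psiPoly (k : ℕ) :
    X * psiPoly (k + 2) =
      (k + 1 : ℚ) • psiPoly (k + 3) - (k + 1 : ℚ) • psiPoly (k + 2) + psiPoly 2 := by
  have hC : C (k + 1 : ℚ) * C ((k + 1 : ℚ)⁻¹) = 1 := by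
    rw [← C_mul, mul_inv_cancel₀ (by positivity), C_1]
  simp only [smul_eq_C_mul]
  rw [show psiPoly (k + 3) = _ from psiPoly.eq_4 k, show psiPoly 2 = X ^ 2 from psiPoly.eq_3]
  linear_combination (-((X + C (k + 1 : ℚ)) * psiPoly (k + 2) - X ^ 2)) * hC

open Polynomial in
theorem X_pow_mem_span_psiPoly (m : ℕ) :
    (X ^ (m + 2) : ℚ[X]) ∈ Submodule.span ℚ (psiPoly '' (Finset.Icc 2 (m + 2) : Finset ℕ)) := by
  induction m with
  | zero => exact Submodule.subset_span ⟨2, by simp, by simp [psiPoly]⟩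
  | succ m ih =>
    rw [pow_succ' X (m + 2)]
    refine Submodule.span_induction (p := fun q _ => X * q ∈ Submodule.span ℚ
      (psiPoly '' (Finset.Icc 2 (m + 1 + 2) : Finset ℕ))) ?_ (by simp) ?_ ?_ ih
    · rintro _ ⟨k, hk, rfl⟩
      obtain ⟨hk2, hkm⟩ := Finset.mem_Icc.1 (Finset.mem_coe.1 hk)
      obtain ⟨k, rfl⟩ := Nat.exists_eq_add_of_le' hk2
      rw [X_mul_psiPoly]
      have mem (j : ℕ) (h2 : 2 ≤ j) (hj : j ≤ m + 1 + 2) : psiPoly j ∈ Submodule.span ℚ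
          (psiPoly '' (Finset.Icc 2 (m + 1 + 2) : Finset ℕ)) :=
        Submodule.subset_span ⟨j, by simp [h2, hj], rfl⟩
      exact add_mem (sub_mem (Submodule.smul_mem _ _ (mem _ (by omega) (by omega)))
        (Submodule.smul_mem _ _ (mem _ (by omega) (by omega)))) (mem _ le_rfl (by omega))
    · intro p q _ _ hp hq
      rw [mul_add]
      exact add_mem hp hq
    · intro r p _ hp
      rw [mul_smul_comm]
      exact Submodule.smul_mem _ _ hp

open Polynomial in
/-- A polynomial identity over `ℚ` may be checked at the positive integers. -/
theorem eq_of_eval_nat_succ_eq {p q : ℚ[X]}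
    (h : ∀ a : ℕ, p.eval ((a + 1 : ℕ) : ℚ) = q.eval ((a + 1 : ℕ) : ℚ)) : p = q := by
  refine eq_of_infinite_eval_eq p q
    ((Set.infinite_range_of_injective (f := fun a : ℕ => ((a + 1 : ℕ) : ℚ)) ?_).mono ?_)
  · intro a b hab
    simpa using hab
  · rintro _ ⟨a, rfl⟩
    exact h a

open Polynomial in
theorem X_pow_eq_sum_psiPoly_iff (m : ℕ) (c : ℕ → ℚ) :
    X ^ m = ∑ k ∈ Finset.Icc 2 m, c k • psiPoly k ↔
      ∀ n : ℕ, 1 ≤ n → (n : ℚ) ^ m = ∑ k ∈ Finset.Icc 2 m, c k * psi k n := by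
  have key (a : ℕ) : (∑ k ∈ Finset.Icc 2 m, c k • psiPoly k).eval ((a + 1 : ℕ) : ℚ) =
      ∑ k ∈ Finset.Icc 2 m, c k * psi k (a + 1) := by
    rw [eval_finsetSum]
    refine Finset.sum_congr rfl fun k hk => ?_
    obtain ⟨k, rfl⟩ := Nat.exists_eq_add_of_le' (Finset.mem_Icc.1 hk).1
    rw [eval_smul, psiPoly_eval, smul_eq_mul]
  constructor
  · intro h n hn
    obtain ⟨a, rfl⟩ := Nat.exists_eq_add_of_le' hn
    rw [← key, ← h, eval_pow, eval_X]
  · intro h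
    refine eq_of_eval_nat_succ_eq fun a => ?_
    rw [key, ← h _ (Nat.le_add_left 1 a), eval_pow, eval_X]

theorem linearIndependent_psiPoly : LinearIndependent ℚ psiPoly :=
  Polynomial.Sequence.linearIndependent ⟨psiPoly, psiPoly_degree⟩

theorem monomial_expansion_exists_unique (m : ℕ) (hm : 2 ≤ m) :
    ∃! c : ℕ → ℚ,
      (∀ k, (k < 2 ∨ m < k) → c k = 0) ∧
        ∀ n : ℕ, 1 ≤ n →
          (n : ℚ) ^ m = ∑ k ∈ Finset.Icc 2 m, c k * psi k n := by
  simp only [← X_pow_eq_sum_psiPoly_iff]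
  refine existsUnique_of_exists_of_unique ?_ ?_
  · obtain ⟨m, rfl⟩ := Nat.exists_eq_add_of_le' hm
    obtain ⟨c, hc⟩ := (Submodule.mem_span_image_finset_iff_exists_fun' ℚ).1
      (X_pow_mem_span_psiPoly m)
    refine ⟨fun k => if k ∈ Finset.Icc 2 (m + 2) then c k else 0, fun k hk => ?_, ?_⟩
    · exact if_neg fun h => by
        rw [Finset.mem_Icc] at h
        omega
    · rw [← hc]
      exact Finset.sum_congr rfl fun k hk => by simp only [if_pos hk]
  · rintro c d ⟨hc0, hc⟩ ⟨hd0, hd⟩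
    funext k
    by_cases hk : k ∈ Finset.Icc 2 m
    · refine sub_eq_zero.1 (linearIndependent_iff'.1 linearIndependent_psiPoly (Finset.Icc 2 m)
        (fun k => c k - d k) ?_ k hk)
      simp only [sub_smul, Finset.sum_sub_distrib]
      rw [← hc, ← hd, sub_self]
    · have hk' : k < 2 ∨ m < k := by
        rw [Finset.mem_Icc] at hk
        omega
      rw [hc0 k hk', hd0 k hk']
end

section
/- Let m ≥ 2 and let c₂, …, c_m be rational numbers such that n^m = Σ_{k=2}^{m} c_k·ψ_k(n) for every natural number n ≥ 1. Then for every a ≥ 0 and every n ≥ 1 the a-th order power sum satisfies S_m^{(a)}(n) = Σ_{k=2}^{m} c_k·ψ_k^{(a)}(n). -/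
/-- `powSum m a n = S_m^{(a)}(n)`: `S_m^{(0)}(n) = n^m` and
`S_m^{(a)}(n) = Σ_{ν=1}^{n} S_m^{(a−1)}(ν)` for `a ≥ 1`. -/
def powSum (m : ℕ) : ℕ → ℕ → ℕ
  | 0, n => n ^ m
  | a + 1, n => ∑ ν ∈ Finset.Icc 1 n, powSum m a ν

theorem psiA_succ_eq_sum (m a n : ℕ) :
    psiA m (a + 1) n = ∑ ν ∈ Finset.Icc 1 n, psiA m a ν := by
  induction n with
  | zero => simp [psiA]
  | succ n ih => rw [psiA, ih, Finset.sum_Icc_succ_top (Nat.le_add_left 1 n)]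

theorem powSum_psi_expansion (m : ℕ) (hm : 2 ≤ m) (c : ℕ → ℚ)
    (hc : ∀ n : ℕ, 1 ≤ n → (n : ℚ) ^ m = ∑ k ∈ Finset.Icc 2 m, c k * psi k n) :
    ∀ a : ℕ, ∀ n : ℕ, 1 ≤ n →
      (powSum m a n : ℚ) = ∑ k ∈ Finset.Icc 2 m, c k * psiA k a n := by
  intro a
  induction a with
  | zero =>
    intro n hn
    simpa [powSum, psiA] using hc n hn
  | succ a ih =>
    intro n _
    simp only [powSum, psiA_succ_eq_sum, Nat.cast_sum, Finset.mul_sum]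
    rw [Finset.sum_comm]
    exact Finset.sum_congr rfl fun ν hν => ih ν (Finset.mem_Icc.mp hν).1
end

section
/- For every natural number n ≥ 1, n⁵ = 6·ψ₅(n) − 10·ψ₄(n) + 5·ψ₃(n). -/
theorem factorial_mul_binom (a b : ℕ) : a.factorial * binom a b = (b + 1).ascFactorial a := by
  rw [Nat.ascFactorial_eq_factorial_mul_choose, binom, Nat.add_comm a b]

theorem pow_psi_expansion_5 (n : ℕ) (hn : 1 ≤ n) :
    (n : ℚ) ^ 5 = 6 * psi 5 n - 10 * psi 4 n + 5 * psi 3 n := by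
  obtain ⟨k, rfl⟩ := Nat.exists_eq_add_of_le' hn
  have h₂ := congrArg (Nat.cast (R := ℚ)) (factorial_mul_binom 2 k)
  have h₃ := congrArg (Nat.cast (R := ℚ)) (factorial_mul_binom 3 k)
  have h₄ := congrArg (Nat.cast (R := ℚ)) (factorial_mul_binom 4 k)
  simp only [Nat.ascFactorial, Nat.factorial] at h₂ h₃ h₄
  simp only [psi, Nat.add_sub_cancel, Nat.reduceSub]
  push_cast at h₂ h₃ h₄ ⊢
  linear_combination (-k : ℚ) * h₄ + 5 * k * h₃ - 5 * k * h₂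
end

section
/- For every natural number n ≥ 1, n⁶ = ψ₂(n) − 10·ψ₃(n) + 40·ψ₄(n) − 54·ψ₅(n) + 24·ψ₆(n). -/
theorem binom_zero_left (b : ℕ) : binom 0 b = 1 := by
  simp [binom]

theorem cast_binom_succ_left (a b : ℕ) :
    (binom (a + 1) b : ℚ) = (a + b + 1) * binom a b / (a + 1) := by
  have h := Nat.add_one_mul_choose_eq (a + b) a
  rw [eq_div_iff (by positivity), binom, binom, Nat.add_right_comm a 1 b]
  exact_mod_cast h.symm

theorem pow_psi_expansion_6 (n : ℕ) (hn : 1 ≤ n) :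
    (n : ℚ) ^ 6 = psi 2 n - 10 * psi 3 n + 40 * psi 4 n - 54 * psi 5 n + 24 * psi 6 n := by
  obtain ⟨k, rfl⟩ := Nat.exists_eq_add_of_le' hn
  simp only [psi, Nat.add_one_sub_one]
  push_cast
  rw [cast_binom_succ_left 4, cast_binom_succ_left 3, cast_binom_succ_left 2,
    cast_binom_succ_left 1, cast_binom_succ_left 0, binom_zero_left]
  push_cast
  ring
end

section
/- For every natural number n ≥ 1, n⁸ = 720·ψ₈(n) − 2400·ψ₇(n) + 3024·ψ₆(n) − 1764·ψ₅(n) + 462·ψ₄(n) − 42·ψ₃(n) + ψ₂(n). -/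
theorem cast_psi_succ_succ (m n : ℕ) :
    (psi (m + 1) (n + 1) : ℚ) = n + 1 + m * n * binom m n := by
  simp [psi]

theorem pow_psi_expansion_8 (n : ℕ) (hn : 1 ≤ n) :
    (n : ℚ) ^ 8 = 720 * psi 8 n - 2400 * psi 7 n + 3024 * psi 6 n - 1764 * psi 5 n + 462 * psi 4 n - 42 * psi 3 n + psi 2 n := by
  obtain ⟨k, rfl⟩ := Nat.exists_eq_add_of_le' hn
  have h1 := cast_binom_succ_left 0 k
  have h2 := cast_binom_succ_left 1 k
  have h3 := cast_binom_succ_left 2 k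
  have h4 := cast_binom_succ_left 3 k
  have h5 := cast_binom_succ_left 4 k
  have h6 := cast_binom_succ_left 5 k
  have h7 := cast_binom_succ_left 6 k
  norm_num only [binom_zero_left] at h1 h2 h3 h4 h5 h6 h7
  rw [cast_psi_succ_succ 7, cast_psi_succ_succ 6, cast_psi_succ_succ 5, cast_psi_succ_succ 4,
    cast_psi_succ_succ 3, cast_psi_succ_succ 2, cast_psi_succ_succ 1,
    h7, h6, h5, h4, h3, h2, h1]
  push_cast
  ring
end

section
/- For every natural number n ≥ 1, the second-order power sum of eighth powers satisfies S₈^{(2)}(n) = Σ_{ν₂=1}^{n} Σ_{ν₁=1}^{ν₂} ν₁⁸ = (1/180)·n·(n+1)²·(n+2)·(2n² + 4n − 1)·(n⁴ + 4n³ + n² − 6n + 3), as an identity of rational numbers. -/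
theorem sum_Icc_pow_eight (n : ℕ) :
    (∑ k ∈ Finset.Icc 1 n, (k : ℚ) ^ 8) =
      n * (n + 1) * (2 * n + 1) *
        (5 * n ^ 6 + 15 * n ^ 5 + 5 * n ^ 4 - 15 * n ^ 3 - n ^ 2 + 9 * n - 3) / 90 := by
  induction n with
  | zero => simp
  | succ n ih =>
    rw [Finset.sum_Icc_succ_top (by omega), ih]
    push_cast
    ring

theorem second_order_sum_of_eighth_powers (n : ℕ) (hn : 1 ≤ n) :
    (∑ ν₂ ∈ Finset.Icc 1 n, ∑ ν₁ ∈ Finset.Icc 1 ν₂, (ν₁ : ℚ) ^ 8) =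
      (1 / 180) * n * (n + 1) ^ 2 * (n + 2) * (2 * n ^ 2 + 4 * n - 1) *
        (n ^ 4 + 4 * n ^ 3 + n ^ 2 - 6 * n + 3) := by
  induction n, hn using Nat.le_induction with
  | base => norm_num
  | succ n hn ih =>
    rw [Finset.sum_Icc_succ_top (by omega), ih, sum_Icc_pow_eight]
    push_cast
    ring
end

section
/- Let m ≥ 2 and let c₂, …, c_m be rational numbers such that ν^m = Σ_{k=2}^{m} c_k·ψ_k(ν) for every natural number ν ≥ 1. Then for every natural number n ≥ 1, Σ_{k=2}^{m} c_k·ψ_k^{(1)}(n) = (1/(m+1))·Σ_{l=1}^{m+1} C(m+1, l)·B_{m+1−l}·n^l, where B_j are the Bernoulli numbers with the convention B₁ = 1/2; that is, the ψ-expansion of the first-order power sum agrees with Bernoulli's formula. -/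
theorem psiA_one_eq_sum (k n : ℕ) : psiA k 1 n = ∑ ν ∈ Finset.Ico 1 (n + 1), psi k ν := by
  induction n with
  | zero => simp [psiA]
  | succ n ih => rw [Finset.sum_Ico_succ_top (by omega), ← ih, psiA, psiA]

/-- Faulhaber's formula, indexed by the exponent of `n`. -/
theorem sum_Ico_pow_eq_sum_Icc (n m : ℕ) :
    ∑ ν ∈ Finset.Ico 1 (n + 1), (ν : ℚ) ^ m =
      (1 / (m + 1 : ℚ)) * ∑ l ∈ Finset.Icc 1 (m + 1),
        (Nat.choose (m + 1) l : ℚ) * bernoulli' (m + 1 - l) * (n : ℚ) ^ l := by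
  rw [sum_Ico_pow, Finset.mul_sum]
  refine Finset.sum_nbij' (m + 1 - ·) (m + 1 - ·) ?_ ?_ ?_ ?_ ?_ <;>
    simp only [Finset.mem_range, Finset.mem_Icc]
  case refine_5 =>
    intro i hi
    rw [Nat.choose_symm hi.le, Nat.sub_sub_self hi.le]
    ring
  all_goals omega

theorem psi_expansion_agrees_with_bernoulli (m : ℕ) (hm : 2 ≤ m) (c : ℕ → ℚ)
    (hc : ∀ ν : ℕ, 1 ≤ ν → (ν : ℚ) ^ m = ∑ k ∈ Finset.Icc 2 m, c k * psi k ν) :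
    ∀ n : ℕ, 1 ≤ n →
      (∑ k ∈ Finset.Icc 2 m, c k * psiA k 1 n) =
        (1 / (m + 1 : ℚ)) * ∑ l ∈ Finset.Icc 1 (m + 1),
          (Nat.choose (m + 1) l : ℚ) * bernoulli' (m + 1 - l) * (n : ℚ) ^ l := by
  intro n _
  rw [← sum_Ico_pow_eq_sum_Icc,
    Finset.sum_congr rfl fun ν hν => hc ν (Finset.mem_Ico.mp hν).1, Finset.sum_comm]
  simp only [psiA_one_eq_sum, Nat.cast_sum, Finset.mul_sum]
end
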